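/- Fix w in the unit disk, an integer N ≥ 1, and a real β < N. Define f_w(z) = (1-|w|)(z-w)^N / (1 - z·conj(w))^{N-β+1}. Then there is a constant C = C(N, β), independent of w, such that |f_w^{(N)}(z)| ≤ C(1-|z|)^{β-N} for all z in the unit disk. -/

import Mathlib

open Metric

lemma iteratedDeriv_one_sub_mul_cpow (a s : ℂ) (k : ℕ) :
    ∀ z : ℂ, 1 - z * a ∈ Complex.slitPlane →
      iteratedDeriv k (fun z : ℂ => (1 - z * a) ^ s) z =
        (∏ i ∈ Finset.range k, (s - i)) * (-a) ^ k * (1 - z * a) ^ (s - k) := by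
  induction k with
  | zero => simp
  | succ k ih =>
    intro z hz
    have hopen : IsOpen {z : ℂ | 1 - z * a ∈ Complex.slitPlane} :=
      Complex.isOpen_slitPlane.preimage (by fun_prop)
    have hev : iteratedDeriv k (fun z : ℂ => (1 - z * a) ^ s) =ᶠ[nhds z] fun z =>
        (∏ i ∈ Finset.range k, (s - i)) * (-a) ^ k * (1 - z * a) ^ (s - k) :=
      Filter.eventuallyEq_of_mem (hopen.mem_nhds hz) ih
    have hlin : HasDerivAt (fun z : ℂ => 1 - z * a) (-a) z := by
      simpa using ((hasDerivAt_id z).mul_const a).const_sub 1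
    rw [iteratedDeriv_succ, hev.deriv_eq, ((hlin.cpow_const hz).const_mul _).deriv,
      Finset.prod_range_succ, Nat.cast_succ, ← sub_sub]
    ring

lemma one_sub_norm_le_norm_one_sub_mul_conj {z w : ℂ} (hw : ‖w‖ ≤ 1) :
    1 - ‖z‖ ≤ ‖1 - z * (starRingEnd ℂ) w‖ := by
  have h := norm_sub_norm_le (1 : ℂ) (z * (starRingEnd ℂ) w)
  rw [norm_one, norm_mul, RCLike.norm_conj] at h
  nlinarith [norm_nonneg z]

lemma norm_sub_le_norm_one_sub_mul_conj {z w : ℂ} (hz : ‖z‖ ≤ 1) (hw : ‖w‖ ≤ 1) :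
    ‖z - w‖ ≤ ‖1 - z * (starRingEnd ℂ) w‖ := by
  have key : ‖1 - z * (starRingEnd ℂ) w‖ ^ 2 - ‖z - w‖ ^ 2 =
      (1 - ‖z‖ ^ 2) * (1 - ‖w‖ ^ 2) := by
    simp only [← Complex.normSq_eq_norm_sq, Complex.normSq_apply, Complex.sub_re, Complex.sub_im,
      Complex.mul_re, Complex.mul_im, Complex.conj_re, Complex.conj_im, Complex.one_re,
      Complex.one_im]
    ring
  have hpos : 0 ≤ (1 - ‖z‖ ^ 2) * (1 - ‖w‖ ^ 2) :=
    mul_nonneg (by nlinarith [norm_nonneg z]) (by nlinarith [norm_nonneg w])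
  exact le_of_sq_le_sq (by linarith) (norm_nonneg _)

lemma one_sub_mul_conj_mem_slitPlane {z w : ℂ} (hz : ‖z‖ < 1) (hw : ‖w‖ ≤ 1) :
    1 - z * (starRingEnd ℂ) w ∈ Complex.slitPlane := by
  refine Or.inl ?_
  have h := Complex.re_le_norm (z * (starRingEnd ℂ) w)
  rw [norm_mul, RCLike.norm_conj] at h
  rw [Complex.sub_re, Complex.one_re]
  nlinarith [norm_nonneg z]

/-- The `N`-th derivative of `(1 - z * conj w) ^ s * (z - w) ^ N` is bounded by a multiple of
`‖1 - z * conj w‖ ^ s` that depends only on `N` and `s`. -/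
lemma norm_iteratedDeriv_cpow_mul_sub_pow_le (N : ℕ) (s : ℝ) {z w : ℂ} (hz : ‖z‖ < 1)
    (hw : ‖w‖ ≤ 1) :
    ‖iteratedDeriv N ((fun z : ℂ => (1 - z * (starRingEnd ℂ) w) ^ (s : ℂ)) *
        fun z : ℂ => (z - w) ^ N) z‖ ≤
      (∑ i ∈ Finset.range (N + 1), N.choose i * ‖∏ j ∈ Finset.range i, ((s : ℂ) - j)‖ *
        N.descFactorial (N - i)) * ‖1 - z * (starRingEnd ℂ) w‖ ^ s := by
  have hslit := one_sub_mul_conj_mem_slitPlane hz hw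
  have hpos : 0 < ‖1 - z * (starRingEnd ℂ) w‖ :=
    norm_pos_iff.mpr (Complex.slitPlane_ne_zero hslit)
  have hcpow : ContDiffAt ℂ N (fun z : ℂ => (1 - z * (starRingEnd ℂ) w) ^ (s : ℂ)) z := by
    have han : AnalyticAt ℂ (fun z : ℂ => (1 - z * (starRingEnd ℂ) w) ^ (s : ℂ)) z :=
      AnalyticAt.cpow (by fun_prop) (by fun_prop) hslit
    exact han.contDiffAt
  rw [iteratedDeriv_mul hcpow (by fun_prop), Finset.sum_mul]
  refine norm_sum_le_of_le _ fun i hi => ?_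
  have hiN : i ≤ N := Nat.lt_succ_iff.mp (Finset.mem_range.mp hi)
  have hpow : iteratedDeriv (N - i) (fun z : ℂ => (z - w) ^ N) z =
      N.descFactorial (N - i) * (z - w) ^ i := by
    rw [iteratedDeriv_comp_sub_const (N - i) (fun z : ℂ => z ^ N) w]
    simp only [iteratedDeriv_pow, Nat.sub_sub_self hiN]
  have hnorm : ‖(1 - z * (starRingEnd ℂ) w) ^ ((s : ℂ) - i)‖ =
      ‖1 - z * (starRingEnd ℂ) w‖ ^ s / ‖1 - z * (starRingEnd ℂ) w‖ ^ i := by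
    rw [← Real.rpow_sub_natCast hpos.ne', ← Complex.norm_cpow_real]
    push_cast
    rfl
  rw [iteratedDeriv_one_sub_mul_cpow _ _ _ _ hslit, hpow]
  simp only [norm_mul, norm_pow, norm_neg, RCLike.norm_conj, Complex.norm_natCast, hnorm]
  have hw_pow : ‖w‖ ^ i ≤ 1 := pow_le_one₀ (norm_nonneg w) hw
  have hquot : ‖z - w‖ ^ i / ‖1 - z * (starRingEnd ℂ) w‖ ^ i ≤ 1 :=
    div_le_one_of_le₀ (pow_le_pow_left₀ (norm_nonneg _)
      (norm_sub_le_norm_one_sub_mul_conj hz.le hw) i) (by positivity)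
  calc _ = N.choose i * ‖∏ j ∈ Finset.range i, ((s : ℂ) - j)‖ * N.descFactorial (N - i) *
        ‖1 - z * (starRingEnd ℂ) w‖ ^ s *
        (‖w‖ ^ i * (‖z - w‖ ^ i / ‖1 - z * (starRingEnd ℂ) w‖ ^ i)) := by ring
    _ ≤ _ := mul_le_of_le_one_right (by positivity)
        (mul_le_one₀ hw_pow (by positivity) hquot)

theorem test_function_lipschitz_bound (N : ℕ) (β : ℝ) (hN : 1 ≤ N) (hβ : β < N) :
    ∃ C : ℝ, 0 < C ∧ ∀ w ∈ ball (0:ℂ) 1, ∀ z ∈ ball (0:ℂ) 1,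
      ‖iteratedDeriv N
          (fun z : ℂ => ((1 - ‖w‖ : ℝ) : ℂ) * (z - w) ^ N /
            (1 - z * (starRingEnd ℂ) w) ^ ((N : ℂ) - (β : ℂ) + 1)) z‖
        ≤ C * (1 - ‖z‖) ^ (β - N) := by
  set s : ℝ := β - N - 1 with hs
  set K : ℝ := ∑ i ∈ Finset.range (N + 1), N.choose i *
    ‖∏ j ∈ Finset.range i, ((s : ℂ) - j)‖ * N.descFactorial (N - i)
  have hK0 : 0 ≤ K := Finset.sum_nonneg fun i _ => by positivity
  refine ⟨K + 1, by linarith, fun w hw z hz => ?_⟩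
  rw [mem_ball_zero_iff] at hw hz
  have hfun : (fun z : ℂ => ((1 - ‖w‖ : ℝ) : ℂ) * (z - w) ^ N /
      (1 - z * (starRingEnd ℂ) w) ^ ((N : ℂ) - (β : ℂ) + 1)) =
      fun z => ((1 - ‖w‖ : ℝ) : ℂ) * ((fun z : ℂ => (1 - z * (starRingEnd ℂ) w) ^ (s : ℂ)) *
        fun z : ℂ => (z - w) ^ N) z := by
    funext z
    have hexp : (s : ℂ) = -((N : ℂ) - (β : ℂ) + 1) := by rw [hs]; push_cast; ring
    rw [Pi.mul_apply, hexp, Complex.cpow_neg]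
    ring
  have hzu := one_sub_norm_le_norm_one_sub_mul_conj (z := z) hw.le
  have hwu : 1 - ‖w‖ ≤ ‖1 - z * (starRingEnd ℂ) w‖ := by
    have h := one_sub_norm_le_norm_one_sub_mul_conj (z := w) hz.le
    rwa [← RCLike.norm_conj (1 - w * (starRingEnd ℂ) z), map_sub, map_one, map_mul,
      RCLike.conj_conj, mul_comm] at h
  set u := ‖1 - z * (starRingEnd ℂ) w‖
  have hupos : 0 < u := by linarith
  rw [hfun, iteratedDeriv_const_mul_field, norm_mul, Complex.norm_real,
    Real.norm_of_nonneg (by linarith)]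
  calc (1 - ‖w‖) * _ ≤ u * (K * u ^ s) :=
        mul_le_mul hwu (norm_iteratedDeriv_cpow_mul_sub_pow_le N s hz hw.le) (norm_nonneg _)
          hupos.le
    _ = K * u ^ (β - N) := by
        rw [hs, Real.rpow_sub_one hupos.ne']
        field_simp
    _ ≤ (K + 1) * (1 - ‖z‖) ^ (β - N) :=
        mul_le_mul (by linarith)
          (Real.rpow_le_rpow_of_nonpos (by linarith) hzu (by linarith)) (by positivity)
          (by linarith)
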